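/- Let f : ℝⁿ → ℝ be C¹ with ∇f ≠ 0 everywhere. If for some level λ and point p in the level set S_λ = {x : f(x) = λ} there is a neighborhood on which S_λ is the graph of a C² function η over a domain 𝒟 ⊂ ℝ^{n−1} (i.e., f(x', η(x')) = λ for x' ∈ 𝒟), and f is a weak solution of div(∇f/|∇f|) = 0, then η satisfies the minimal surface equation div(∇η/√(1 + |∇η|²)) = 0 on 𝒟. -/

import Mathlib

open MeasureTheory RealInnerProductSpace

/-- The linear map `(x, t) ↦ (x₁, …, xₙ, t)` from `ℝⁿ × ℝ` to `ℝⁿ⁺¹`. -/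
noncomputable def snocL (n : ℕ) :
    EuclideanSpace ℝ (Fin n) × ℝ →L[ℝ] EuclideanSpace ℝ (Fin (n + 1)) :=
  LinearMap.toContinuousLinearMap
    { toFun := fun p => (WithLp.equiv 2 (Fin (n + 1) → ℝ)).symm (Fin.snoc (⇑p.1) p.2)
      map_add' := fun p q => by
        ext i
        refine Fin.lastCases ?_ (fun j => ?_) i <;> simp
      map_smul' := fun c p => by
        ext i
        refine Fin.lastCases ?_ (fun j => ?_) i <;> simp }

theorem snocL_apply (n : ℕ) (p : EuclideanSpace ℝ (Fin n) × ℝ) :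
    snocL n p = (WithLp.equiv 2 (Fin (n + 1) → ℝ)).symm (Fin.snoc (⇑p.1) p.2) := rfl

@[simp]
theorem snocL_castSucc (n : ℕ) (p : EuclideanSpace ℝ (Fin n) × ℝ) (j : Fin n) :
    snocL n p j.castSucc = p.1 j := by
  simp [snocL_apply]

@[simp]
theorem snocL_last (n : ℕ) (p : EuclideanSpace ℝ (Fin n) × ℝ) :
    snocL n p (Fin.last n) = p.2 := by
  simp [snocL_apply]

theorem inner_snocL (n : ℕ) (w : EuclideanSpace ℝ (Fin (n + 1)))
    (p : EuclideanSpace ℝ (Fin n)) (t : ℝ) :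
    ⟪w, snocL n (p, t)⟫ = (∑ j : Fin n, w j.castSucc * p j) + w (Fin.last n) * t := by
  rw [PiLp.inner_apply, Fin.sum_univ_castSucc]
  simp [mul_comm]

theorem norm_snocL (n : ℕ) (p : EuclideanSpace ℝ (Fin n)) (t : ℝ) :
    ‖snocL n (p, t)‖ = Real.sqrt (t ^ 2 + ‖p‖ ^ 2) := by
  rw [EuclideanSpace.norm_eq, EuclideanSpace.real_norm_sq_eq, Fin.sum_univ_castSucc]
  simp [add_comm]

theorem snocL_single_zero (n : ℕ) (j : Fin n) :
    snocL n (EuclideanSpace.single j 1, 0) = EuclideanSpace.single j.castSucc 1 := by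
  ext i
  refine Fin.lastCases ?_ (fun k => ?_) i
  · simp [(Fin.castSucc_lt_last j).ne']
  · simp

theorem snocL_zero_one (n : ℕ) :
    snocL n (0, 1) = EuclideanSpace.single (Fin.last n) 1 := by
  ext i
  refine Fin.lastCases ?_ (fun k => ?_) i
  · simp
  · simp [(Fin.castSucc_lt_last k).ne]

theorem gradient_apply_eq_fderiv {n : ℕ} (h : EuclideanSpace ℝ (Fin n) → ℝ)
    (x : EuclideanSpace ℝ (Fin n)) (j : Fin n) :
    gradient h x j = fderiv ℝ h x (EuclideanSpace.single j 1) := by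
  rw [← inner_gradient_left, EuclideanSpace.inner_single_right]
  simp

theorem ContDiff.continuous_gradient {F : Type*} [NormedAddCommGroup F] [InnerProductSpace ℝ F]
    [CompleteSpace F] {h : F → ℝ} (hh : ContDiff ℝ 1 h) : Continuous (gradient h) := by
  unfold gradient
  exact (InnerProductSpace.toDual ℝ F).symm.continuous.comp (hh.continuous_fderiv one_ne_zero)

theorem integral_mul_fderiv_add_eq_zero {n : ℕ} {φ w : EuclideanSpace ℝ (Fin n) → ℝ}
    (hφ : ContDiff ℝ 1 φ) (hc : HasCompactSupport φ) (hw : ContDiff ℝ 1 w)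
    (v : EuclideanSpace ℝ (Fin n)) :
    Integrable (fun x => φ x * fderiv ℝ w x v + fderiv ℝ φ x v * w x) ∧
    ∫ x, (φ x * fderiv ℝ w x v + fderiv ℝ φ x v * w x) = 0 := by
  have h1 : Integrable (fun x => φ x * fderiv ℝ w x v) :=
    Continuous.integrable_of_hasCompactSupport
      (hφ.continuous.mul ((hw.continuous_fderiv one_ne_zero).clm_apply continuous_const)) hc.mul_right
  have h2 : Integrable (fun x => fderiv ℝ φ x v * w x) :=
    Continuous.integrable_of_hasCompactSupport
      (((hφ.continuous_fderiv one_ne_zero).clm_apply continuous_const).mul hw.continuous)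
      (hc.fderiv_apply (𝕜 := ℝ) v).mul_right
  have h3 : Integrable (fun x => φ x * w x) :=
    Continuous.integrable_of_hasCompactSupport (hφ.continuous.mul hw.continuous) hc.mul_right
  refine ⟨h1.add h2, ?_⟩
  rw [integral_add h1 h2, integral_mul_fderiv_eq_neg_fderiv_mul_of_integrable h2 h1 h3
    (fun x _ => hφ.differentiable one_ne_zero x) (fun x _ => hw.differentiable one_ne_zero x)]
  simp

/-- First variation of the flux of a divergence-free field through a graph. -/
theorem integral_flux_variation_eq_zero {n : ℕ}
    {V : EuclideanSpace ℝ (Fin (n + 1)) → EuclideanSpace ℝ (Fin (n + 1))}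
    (hV : ContDiff ℝ 1 V)
    (hdiv : ∀ x, ∑ i, fderiv ℝ V x (EuclideanSpace.single i 1) i = 0)
    {h φ : EuclideanSpace ℝ (Fin n) → ℝ} (hh : ContDiff ℝ 1 h)
    (hφ : ContDiff ℝ 1 φ) (hc : HasCompactSupport φ) :
    ∫ x, (φ x * ⟪fderiv ℝ V (snocL n (x, h x)) (snocL n (0, 1)), snocL n (-gradient h x, 1)⟫
      + ⟪V (snocL n (x, h x)), snocL n (-gradient φ x, 0)⟫) = 0 := by
  set W : EuclideanSpace ℝ (Fin n) → EuclideanSpace ℝ (Fin (n + 1)) :=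
    fun x => V (snocL n (x, h x)) with hWdef
  have hW : ContDiff ℝ 1 W := hV.comp ((snocL n).contDiff.comp (contDiff_id.prodMk hh))
  have hWj : ∀ i, ContDiff ℝ 1 (fun x => W x i) := fun i =>
    (EuclideanSpace.proj (𝕜 := ℝ) i).contDiff.comp hW
  have hder : ∀ x i v, fderiv ℝ (fun x => W x i) x v
      = fderiv ℝ V (snocL n (x, h x)) (snocL n (v, fderiv ℝ h x v)) i := by
    intro x i v
    have h1 : HasFDerivAt (fun x => snocL n (x, h x))
        ((snocL n).comp ((ContinuousLinearMap.id ℝ _).prod (fderiv ℝ h x))) x :=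
      (snocL n).hasFDerivAt.comp x
        ((hasFDerivAt_id x).prodMk (hh.differentiable one_ne_zero x).hasFDerivAt)
    have h2 := ((EuclideanSpace.proj (𝕜 := ℝ) i).hasFDerivAt.comp x
      ((hV.differentiable one_ne_zero (snocL n (x, h x))).hasFDerivAt.comp x h1))
    have h3 : HasFDerivAt (fun x => W x i) _ x := h2
    rw [h3.fderiv]
    rfl
  have key : ∀ x, (φ x * ⟪fderiv ℝ V (snocL n (x, h x)) (snocL n (0, 1)),
        snocL n (-gradient h x, 1)⟫ + ⟪V (snocL n (x, h x)), snocL n (-gradient φ x, 0)⟫)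
      = - ∑ j : Fin n, (φ x * fderiv ℝ (fun x => W x j.castSucc) x (EuclideanSpace.single j 1)
        + fderiv ℝ φ x (EuclideanSpace.single j 1) * W x j.castSucc) := by
    intro x
    have hd := hdiv (snocL n (x, h x))
    rw [Fin.sum_univ_castSucc, ← snocL_zero_one] at hd
    simp_rw [← snocL_single_zero] at hd
    have hsp : ∀ j : Fin n, snocL n (EuclideanSpace.single j 1,
        fderiv ℝ h x (EuclideanSpace.single j 1)) = snocL n (EuclideanSpace.single j 1, 0)
          + fderiv ℝ h x (EuclideanSpace.single j 1) • snocL n (0, 1) := by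
      intro j
      rw [← map_smul, ← map_add]
      simp
    simp_rw [inner_snocL, hder, hsp, map_add, map_smul, PiLp.add_apply, PiLp.smul_apply,
      PiLp.neg_apply, gradient_apply_eq_fderiv]
    simp only [Finset.sum_add_distrib, mul_add, smul_eq_mul, ← Finset.mul_sum]
    rw [eq_neg_of_add_eq_zero_right hd]
    simp only [mul_neg, Finset.sum_neg_distrib, mul_one, mul_zero, add_zero, hWdef]
    simp_rw [mul_comm]
    ring
  simp_rw [key, integral_neg]
  rw [integral_finsetSum _ fun j _ => (integral_mul_fderiv_add_eq_zero hφ hc (hWj _) _).1]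
  simp [(integral_mul_fderiv_add_eq_zero hφ hc (hWj _) _).2]

theorem ContDiff.gradient_add_const_mul {n : ℕ} {h φ : EuclideanSpace ℝ (Fin n) → ℝ}
    (hh : ContDiff ℝ 1 h) (hφ : ContDiff ℝ 1 φ) (s : ℝ) (x : EuclideanSpace ℝ (Fin n)) :
    gradient (fun y => h y + s * φ y) x = gradient h x + s • gradient φ x := by
  apply HasGradientAt.gradient
  rw [hasGradientAt_iff_hasFDerivAt]
  have h1 := (hh.differentiable one_ne_zero x).hasGradientAt.hasFDerivAt
  have h2 := (hφ.differentiable one_ne_zero x).hasGradientAt.hasFDerivAt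
  have h3 := h1.add (h2.const_mul s)
  rw [map_add, map_smul]
  exact h3

theorem gradient_eq_zero_of_notMem_tsupport {F : Type*} [NormedAddCommGroup F]
    [InnerProductSpace ℝ F] [CompleteSpace F] {φ : F → ℝ} {x : F} (hx : x ∉ tsupport φ) :
    gradient φ x = 0 := by
  rw [(notMem_tsupport_iff_eventuallyEq.1 hx).gradient_eq]
  exact gradient_fun_const x 0

/-- The flux density of `V` through the graph of `h + s φ`. -/
noncomputable def fluxDensity {n : ℕ}
    (V : EuclideanSpace ℝ (Fin (n + 1)) → EuclideanSpace ℝ (Fin (n + 1)))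
    (h φ : EuclideanSpace ℝ (Fin n) → ℝ) (s : ℝ) (x : EuclideanSpace ℝ (Fin n)) : ℝ :=
  ⟪V (snocL n (x, h x + s * φ x)), snocL n (-(gradient h x + s • gradient φ x), 1)⟫

theorem continuous_fluxDensity {n : ℕ}
    {V : EuclideanSpace ℝ (Fin (n + 1)) → EuclideanSpace ℝ (Fin (n + 1))} (hV : Continuous V)
    {h φ : EuclideanSpace ℝ (Fin n) → ℝ} (hh : ContDiff ℝ 1 h) (hφ : ContDiff ℝ 1 φ) (s : ℝ) :
    Continuous (fluxDensity V h φ s) := by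
  have h1 := hh.continuous
  have h2 := hφ.continuous
  have h3 := hh.continuous_gradient
  have h4 := hφ.continuous_gradient
  unfold fluxDensity
  fun_prop

/-- The derivative of `fluxDensity V h φ s x` with respect to `s`. -/
noncomputable def fluxDensityDeriv {n : ℕ}
    (V : EuclideanSpace ℝ (Fin (n + 1)) → EuclideanSpace ℝ (Fin (n + 1)))
    (h φ : EuclideanSpace ℝ (Fin n) → ℝ) (s : ℝ) (x : EuclideanSpace ℝ (Fin n)) : ℝ :=
  φ x * ⟪fderiv ℝ V (snocL n (x, h x + s * φ x)) (snocL n (0, 1)),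
      snocL n (-(gradient h x + s • gradient φ x), 1)⟫
    + ⟪V (snocL n (x, h x + s * φ x)), snocL n (-gradient φ x, 0)⟫

theorem continuous_fluxDensityDeriv {n : ℕ}
    {V : EuclideanSpace ℝ (Fin (n + 1)) → EuclideanSpace ℝ (Fin (n + 1))} (hV : ContDiff ℝ 1 V)
    {h φ : EuclideanSpace ℝ (Fin n) → ℝ} (hh : ContDiff ℝ 1 h) (hφ : ContDiff ℝ 1 φ) :
    Continuous (fun p : ℝ × EuclideanSpace ℝ (Fin n) => fluxDensityDeriv V h φ p.1 p.2) := by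
  have h1 := hh.continuous
  have h2 := hφ.continuous
  have h3 := hh.continuous_gradient
  have h4 := hφ.continuous_gradient
  have h5 := hV.continuous
  have h6 := hV.continuous_fderiv one_ne_zero
  unfold fluxDensityDeriv
  fun_prop

theorem hasDerivAt_fluxDensity {n : ℕ}
    {V : EuclideanSpace ℝ (Fin (n + 1)) → EuclideanSpace ℝ (Fin (n + 1))} (hV : ContDiff ℝ 1 V)
    (h φ : EuclideanSpace ℝ (Fin n) → ℝ) (s : ℝ) (x : EuclideanSpace ℝ (Fin n)) :
    HasDerivAt (fun s => fluxDensity V h φ s x) (fluxDensityDeriv V h φ s x) s := by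
  have e1 : HasDerivAt (fun s => snocL n (x, h x + s * φ x)) (snocL n (0, 1 * φ x)) s :=
    (snocL n).hasFDerivAt.comp_hasDerivAt s
      ((hasDerivAt_const s x).prodMk (((hasDerivAt_id s).mul_const (φ x)).const_add (h x)))
  have e2 : HasDerivAt (fun s => V (snocL n (x, h x + s * φ x)))
      (fderiv ℝ V (snocL n (x, h x + s * φ x)) (snocL n (0, 1 * φ x))) s :=
    (hV.differentiable one_ne_zero _).hasFDerivAt.comp_hasDerivAt s e1
  have e3 : HasDerivAt (fun s : ℝ => snocL n (-(gradient h x + s • gradient φ x), (1 : ℝ)))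
      (snocL n (-((1 : ℝ) • gradient φ x), 0)) s :=
    (snocL n).hasFDerivAt.comp_hasDerivAt s
      ((((hasDerivAt_id s).smul_const (gradient φ x)).const_add (gradient h x)).fun_neg.prodMk
        (hasDerivAt_const s (1 : ℝ)))
  have e5 : snocL n (0, 1 * φ x) = φ x • snocL n (0, 1) := by
    rw [← map_smul]; simp
  refine (e2.inner ℝ e3).congr_deriv ?_
  rw [e5, map_smul, real_inner_smul_left, add_comm, one_smul, fluxDensityDeriv]

theorem integral_fluxDensityDeriv_eq_zero {n : ℕ}
    {V : EuclideanSpace ℝ (Fin (n + 1)) → EuclideanSpace ℝ (Fin (n + 1))}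
    (hV : ContDiff ℝ 1 V)
    (hdiv : ∀ x, ∑ i, fderiv ℝ V x (EuclideanSpace.single i 1) i = 0)
    {h φ : EuclideanSpace ℝ (Fin n) → ℝ} (hh : ContDiff ℝ 1 h)
    (hφ : ContDiff ℝ 1 φ) (hc : HasCompactSupport φ) (s : ℝ) :
    ∫ x in tsupport φ, fluxDensityDeriv V h φ s x = 0 := by
  rw [setIntegral_eq_integral_of_forall_compl_eq_zero]
  · have := integral_flux_variation_eq_zero hV hdiv
      (h := fun x => h x + s * φ x) (φ := φ) (hh.add (contDiff_const.mul hφ)) hφ hc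
    simp only [hh.gradient_add_const_mul hφ] at this
    exact this
  · intro x hx
    have hz : gradient φ x = 0 := gradient_eq_zero_of_notMem_tsupport hx
    have hz' : φ x = 0 := image_eq_zero_of_notMem_tsupport hx
    have h0 : snocL n (-0, 0) = 0 := by rw [neg_zero]; exact map_zero (snocL n)
    rw [fluxDensityDeriv, hz, hz', h0, inner_zero_right, zero_mul, add_zero]

theorem setIntegral_fluxDensity_eq_of_contDiff {n : ℕ}
    {V : EuclideanSpace ℝ (Fin (n + 1)) → EuclideanSpace ℝ (Fin (n + 1))}
    (hV : ContDiff ℝ 1 V)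
    (hdiv : ∀ x, ∑ i, fderiv ℝ V x (EuclideanSpace.single i 1) i = 0)
    {h φ : EuclideanSpace ℝ (Fin n) → ℝ} (hh : ContDiff ℝ 1 h)
    (hφ : ContDiff ℝ 1 φ) (hc : HasCompactSupport φ) (s : ℝ) :
    ∫ x in tsupport φ, fluxDensity V h φ s x = ∫ x in tsupport φ, fluxDensity V h φ 0 x := by
  have hK : IsCompact (tsupport φ) := hc
  have hg'c := continuous_fluxDensityDeriv hV hh hφ
  have hF : ∀ s, HasDerivAt (fun s => ∫ x in tsupport φ, fluxDensity V h φ s x) 0 s := by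
    intro s
    obtain ⟨C, hC⟩ := ((isCompact_closedBall s 1).prod hK).exists_bound_of_continuousOn
      hg'c.continuousOn
    rw [← integral_fluxDensityDeriv_eq_zero hV hdiv hh hφ hc s]
    refine (hasDerivAt_integral_of_dominated_loc_of_deriv_le (bound := fun _ => C)
      (Metric.closedBall_mem_nhds s one_pos) ?_ ?_ ?_ ?_ ?_ ?_).2
    · exact .of_forall fun t => (continuous_fluxDensity hV.continuous hh hφ t).aestronglyMeasurable
    · exact (continuous_fluxDensity hV.continuous hh hφ s).continuousOn.integrableOn_compact hK
    · exact (hg'c.comp (Continuous.prodMk_right s)).aestronglyMeasurable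
    · exact (ae_restrict_mem (isClosed_tsupport φ).measurableSet).mono
        fun x hx t ht => hC (t, x) ⟨ht, hx⟩
    · exact integrableOn_const hK.measure_lt_top.ne
    · exact .of_forall fun x t _ => hasDerivAt_fluxDensity hV h φ t x
  exact is_const_of_deriv_eq_zero (fun s => (hF s).differentiableAt) (fun s => (hF s).deriv) s 0

theorem sum_fderiv_convolution_eq_zero {m : ℕ}
    {ν : EuclideanSpace ℝ (Fin m) → EuclideanSpace ℝ (Fin m)} (hν : Continuous ν)
    (hweak : ∀ φ : EuclideanSpace ℝ (Fin m) → ℝ,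
      ContDiff ℝ (⊤ : ℕ∞) φ → HasCompactSupport φ → ∫ x, ⟪ν x, gradient φ x⟫ = 0)
    {ρ : EuclideanSpace ℝ (Fin m) → ℝ} (hρ : ContDiff ℝ (⊤ : ℕ∞) ρ) (hc : HasCompactSupport ρ)
    (x : EuclideanSpace ℝ (Fin m)) :
    ∑ i, fderiv ℝ (convolution ρ ν (ContinuousLinearMap.lsmul ℝ ℝ) volume) x
      (EuclideanSpace.single i 1) i = 0 := by
  have hρ1 : ContDiff ℝ 1 ρ := hρ.of_le (by exact_mod_cast le_top)
  have hD := hc.hasFDerivAt_convolution_left (ContinuousLinearMap.lsmul ℝ ℝ) hρ1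
    (hν.locallyIntegrable (μ := volume)) x
  have hex : Integrable (fun t =>
      ((ContinuousLinearMap.lsmul ℝ ℝ).precompL (EuclideanSpace ℝ (Fin m))) (fderiv ℝ ρ t)
        (ν (x - t))) :=
    (hc.fderiv (𝕜 := ℝ)).convolutionExists_left _ (hρ1.continuous_fderiv one_ne_zero)
      hν.locallyIntegrable x
  have hcoord : ∀ i, fderiv ℝ (convolution ρ ν (ContinuousLinearMap.lsmul ℝ ℝ) volume) x
      (EuclideanSpace.single i 1) i = ∫ t, gradient ρ t i * ν (x - t) i := by
    intro i
    rw [hD.fderiv, convolution_def, ContinuousLinearMap.integral_apply hex]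
    have := (EuclideanSpace.proj (𝕜 := ℝ) i).integral_comp_comm
      (hex.apply_continuousLinearMap (EuclideanSpace.single i 1))
    refine Eq.trans this.symm ?_
    congr 1
    ext t
    simp [gradient_apply_eq_fderiv]
  have hint : ∀ i, Integrable (fun t => gradient ρ t i * ν (x - t) i) := by
    intro i
    have h1 : Continuous (gradient ρ) := hρ1.continuous_gradient
    have h2 : HasCompactSupport (fun t => gradient ρ t i) := by
      simp_rw [gradient_apply_eq_fderiv]
      exact hc.fderiv_apply (𝕜 := ℝ) _
    refine Continuous.integrable_of_hasCompactSupport ?_ h2.mul_right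
    fun_prop
  simp_rw [hcoord]
  rw [← integral_finsetSum _ fun i _ => hint i]
  have hsum : ∀ t, ∑ i, gradient ρ t i * ν (x - t) i = ⟪ν (x - t), gradient ρ t⟫ := by
    intro t
    rw [PiLp.inner_apply]
    simp
  simp_rw [hsum]
  rw [← integral_sub_left_eq_self _ volume x]
  simp_rw [sub_sub_cancel]
  have hgr : ∀ t, gradient (fun y => ρ (x - y)) t = - gradient ρ (x - t) := by
    intro t
    apply HasGradientAt.gradient
    rw [hasGradientAt_iff_hasFDerivAt]
    have h1 := (hρ1.differentiable one_ne_zero (x - t)).hasGradientAt.hasFDerivAt.comp t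
      ((hasFDerivAt_id t).const_sub x)
    refine h1.congr_fderiv ?_
    ext v
    simp
  have hcomp : HasCompactSupport (fun y => ρ (x - y)) :=
    hc.comp_homeomorph (Homeomorph.subLeft x)
  have := hweak (fun y => ρ (x - y)) (hρ.comp (contDiff_const.sub contDiff_id)) hcomp
  simp_rw [hgr, inner_neg_right, integral_neg, neg_eq_zero] at this
  exact this

/-- The flux of a bounded, weakly divergence-free continuous field through the graph of `h + s φ`
does not depend on `s`. -/
theorem setIntegral_fluxDensity_eq {n : ℕ}
    {ν : EuclideanSpace ℝ (Fin (n + 1)) → EuclideanSpace ℝ (Fin (n + 1))} (hν : Continuous ν)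
    (hν1 : ∀ x, ‖ν x‖ ≤ 1)
    (hweak : ∀ φ : EuclideanSpace ℝ (Fin (n + 1)) → ℝ,
      ContDiff ℝ (⊤ : ℕ∞) φ → HasCompactSupport φ → ∫ x, ⟪ν x, gradient φ x⟫ = 0)
    {h φ : EuclideanSpace ℝ (Fin n) → ℝ} (hh : ContDiff ℝ 1 h)
    (hφ : ContDiff ℝ 1 φ) (hc : HasCompactSupport φ) (s : ℝ) :
    ∫ x in tsupport φ, fluxDensity ν h φ s x = ∫ x in tsupport φ, fluxDensity ν h φ 0 x := by
  have hK : IsCompact (tsupport φ) := hc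
  let ψ : ℕ → ContDiffBump (0 : EuclideanSpace ℝ (Fin (n + 1))) := fun k =>
    ⟨1 / ((k : ℝ) + 1), 2 * (1 / ((k : ℝ) + 1)), by positivity,
      lt_mul_of_one_lt_left (by positivity) one_lt_two⟩
  have hψ : Filter.Tendsto (fun k => (ψ k).rOut) Filter.atTop (nhds 0) := by
    have := (tendsto_one_div_add_atTop_nhds_zero_nat (𝕜 := ℝ)).const_mul 2
    rw [mul_zero] at this
    exact this
  set V : ℕ → EuclideanSpace ℝ (Fin (n + 1)) → EuclideanSpace ℝ (Fin (n + 1)) := fun k =>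
    convolution ((ψ k).normed volume) ν (ContinuousLinearMap.lsmul ℝ ℝ) volume with hVdef
  have hVs : ∀ k, ContDiff ℝ 1 (V k) := fun k =>
    (ψ k).hasCompactSupport_normed.contDiff_convolution_left _ (ψ k).contDiff_normed
      hν.locallyIntegrable
  have hVdiv : ∀ k x, ∑ i, fderiv ℝ (V k) x (EuclideanSpace.single i 1) i = 0 := fun k x =>
    sum_fderiv_convolution_eq_zero hν hweak (ψ k).contDiff_normed
      (ψ k).hasCompactSupport_normed x
  have hVb : ∀ k x, ‖V k x‖ ≤ 3 := by
    intro k x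
    have h1 : dist (V k x) (ν x) ≤ 2 :=
      (ψ k).dist_normed_convolution_le hν.aestronglyMeasurable fun y _ => by
        rw [dist_eq_norm]
        linarith [norm_sub_le (ν y) (ν x), hν1 x, hν1 y]
    rw [dist_eq_norm] at h1
    have h2 := norm_add_le (V k x - ν x) (ν x)
    rw [sub_add_cancel] at h2
    linarith [hν1 x]
  have hVt : ∀ x, Filter.Tendsto (fun k => V k x) Filter.atTop (nhds (ν x)) := fun x =>
    ContDiffBump.convolution_tendsto_right_of_continuous hψ hν x
  have hlim : ∀ s, Filter.Tendsto (fun k => ∫ x in tsupport φ, fluxDensity (V k) h φ s x)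
      Filter.atTop (nhds (∫ x in tsupport φ, fluxDensity ν h φ s x)) := by
    intro s
    have c3 := hh.continuous_gradient
    have c4 := hφ.continuous_gradient
    refine tendsto_integral_of_dominated_convergence
      (fun x => 3 * ‖snocL n (-(gradient h x + s • gradient φ x), 1)‖) ?_ ?_ ?_ ?_
    · exact fun k => (continuous_fluxDensity (hVs k).continuous hh hφ s).aestronglyMeasurable
    · refine ContinuousOn.integrableOn_compact hK ?_
      fun_prop
    · refine fun k => .of_forall fun x => (norm_inner_le_norm _ _).trans ?_
      gcongr
      exact hVb k _
    · exact .of_forall fun x => (hVt _).inner tendsto_const_nhds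
  refine tendsto_nhds_unique (hlim s) ((hlim 0).congr fun k => ?_)
  exact (setIntegral_fluxDensity_eq_of_contDiff (hVs k) (hVdiv k) hh hφ hc s).symm

theorem integrable_inner_normalized_gradient {n : ℕ} {h φ : EuclideanSpace ℝ (Fin n) → ℝ}
    (hh : ContDiff ℝ 1 h) (hφ : ContDiff ℝ 1 φ) (hc : HasCompactSupport φ) :
    Integrable fun x =>
      ⟪(Real.sqrt (1 + ‖gradient h x‖ ^ 2))⁻¹ • gradient h x, gradient φ x⟫ := by
  have c3 := hh.continuous_gradient
  have c4 := hφ.continuous_gradient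
  have c5 : Continuous fun x => (Real.sqrt (1 + ‖gradient h x‖ ^ 2))⁻¹ :=
    Continuous.inv₀ (by fun_prop) fun x => (Real.sqrt_pos.2 (by positivity)).ne'
  refine Continuous.integrable_of_hasCompactSupport (by fun_prop) ?_
  refine HasCompactSupport.intro hc fun x hx => ?_
  rw [gradient_eq_zero_of_notMem_tsupport hx, inner_zero_right]

/-- A graph whose unit normal extends to a continuous, weakly divergence-free field of norm at most
one is a weak solution of the minimal surface equation. -/
theorem integral_inner_gradient_eq_zero_of_calibrated {n : ℕ}
    {ν : EuclideanSpace ℝ (Fin (n + 1)) → EuclideanSpace ℝ (Fin (n + 1))} (hν : Continuous ν)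
    (hν1 : ∀ x, ‖ν x‖ ≤ 1)
    (hweak : ∀ φ : EuclideanSpace ℝ (Fin (n + 1)) → ℝ,
      ContDiff ℝ (⊤ : ℕ∞) φ → HasCompactSupport φ → ∫ x, ⟪ν x, gradient φ x⟫ = 0)
    {h φ : EuclideanSpace ℝ (Fin n) → ℝ} (hh : ContDiff ℝ 1 h)
    (hφ : ContDiff ℝ 1 φ) (hc : HasCompactSupport φ)
    (hcal : ∀ x ∈ tsupport φ, ⟪ν (snocL n (x, h x)), snocL n (-gradient h x, 1)⟫
      = Real.sqrt (1 + ‖gradient h x‖ ^ 2)) :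
    ∫ x, ⟪(Real.sqrt (1 + ‖gradient h x‖ ^ 2))⁻¹ • gradient h x, gradient φ x⟫ = 0 := by
  have hK : IsCompact (tsupport φ) := hc
  have c4 := hφ.continuous_gradient
  rw [← setIntegral_eq_integral_of_forall_compl_eq_zero (s := tsupport φ) fun x hx => by
    rw [gradient_eq_zero_of_notMem_tsupport hx, inner_zero_right]]
  set b : EuclideanSpace ℝ (Fin n) → ℝ := fun x =>
    ⟪(Real.sqrt (1 + ‖gradient h x‖ ^ 2))⁻¹ • gradient h x, gradient φ x⟫ with hb
  have hr : ∀ x, 1 ≤ Real.sqrt (1 + ‖gradient h x‖ ^ 2) := fun x => by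
    rw [Real.one_le_sqrt]
    linarith [sq_nonneg ‖gradient h x‖]
  have hbi : IntegrableOn b (tsupport φ) :=
    (integrable_inner_normalized_gradient hh hφ hc).integrableOn
  have hqi : IntegrableOn (fun x => ‖gradient φ x‖ ^ 2 / 2) (tsupport φ) := by
    refine ContinuousOn.integrableOn_compact hK ?_
    fun_prop
  have hfi : ∀ s, IntegrableOn (fluxDensity ν h φ s) (tsupport φ) := fun s =>
    (continuous_fluxDensity hν hh hφ s).continuousOn.integrableOn_compact hK
  have hpt : ∀ s, ∀ x ∈ tsupport φ, fluxDensity ν h φ s x - fluxDensity ν h φ 0 x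
      ≤ s * b x + s ^ 2 * (‖gradient φ x‖ ^ 2 / 2) := by
    intro s x hx
    have h0 : fluxDensity ν h φ 0 x = Real.sqrt (1 + ‖gradient h x‖ ^ 2) := by
      rw [← hcal x hx, fluxDensity]
      simp only [zero_mul, zero_smul, add_zero]
    have hs : fluxDensity ν h φ s x ≤ Real.sqrt (1 + ‖gradient h x + s • gradient φ x‖ ^ 2) := by
      refine (real_inner_le_norm _ _).trans ?_
      rw [norm_snocL, norm_neg, one_pow]
      exact mul_le_of_le_one_left (Real.sqrt_nonneg _) (hν1 _)
    rw [h0]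
    have hbx : b x = ⟪gradient h x, gradient φ x⟫ / Real.sqrt (1 + ‖gradient h x‖ ^ 2) := by
      simp only [hb]
      rw [real_inner_smul_left, div_eq_inv_mul]
    rw [hbx]
    have hRsq := Real.sq_sqrt (x := 1 + ‖gradient h x + s • gradient φ x‖ ^ 2) (by positivity)
    have hrsq := Real.sq_sqrt (x := 1 + ‖gradient h x‖ ^ 2) (by positivity)
    have hexp : ‖gradient h x + s • gradient φ x‖ ^ 2 = ‖gradient h x‖ ^ 2
        + 2 * s * ⟪gradient h x, gradient φ x⟫ + s ^ 2 * ‖gradient φ x‖ ^ 2 := by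
      rw [norm_add_sq_real, real_inner_smul_right, norm_smul, mul_pow, Real.norm_eq_abs, sq_abs]
      ring
    rw [hexp] at hRsq
    rw [hexp] at hs
    have hr1 := hr x
    set r := Real.sqrt (1 + ‖gradient h x‖ ^ 2)
    set R := Real.sqrt (1 + (‖gradient h x‖ ^ 2
        + 2 * s * ⟪gradient h x, gradient φ x⟫ + s ^ 2 * ‖gradient φ x‖ ^ 2))
    have hr0 : 0 < r := zero_lt_one.trans_le hr1
    have hq : s ^ 2 * (‖gradient φ x‖ ^ 2 / 2) / r ≤ s ^ 2 * (‖gradient φ x‖ ^ 2 / 2) :=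
      div_le_self (by positivity) hr1
    have hR : R - r ≤ s * (⟪gradient h x, gradient φ x⟫ / r)
        + s ^ 2 * (‖gradient φ x‖ ^ 2 / 2) / r := by
      rw [← mul_div_assoc, ← add_div, le_div_iff₀ hr0]
      nlinarith [sq_nonneg (R - r)]
    linarith
  set I := ∫ x in tsupport φ, b x
  set C := ∫ x in tsupport φ, ‖gradient φ x‖ ^ 2 / 2
  have hC : 0 ≤ C := integral_nonneg fun x => by positivity
  have hquad : ∀ s : ℝ, 0 ≤ s * I + s ^ 2 * C := by
    intro s
    have h1 := setIntegral_mono_on ((hfi s).sub (hfi 0))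
      ((hbi.const_mul s).add (hqi.const_mul (s ^ 2))) (isClosed_tsupport φ).measurableSet (hpt s)
    have h2 : ∫ x in tsupport φ, (fluxDensity ν h φ s x - fluxDensity ν h φ 0 x) = 0 := by
      rw [integral_sub (hfi s) (hfi 0),
        setIntegral_fluxDensity_eq hν hν1 hweak hh hφ hc s, sub_self]
    have h3 : ∫ x in tsupport φ, (s * b x + s ^ 2 * (‖gradient φ x‖ ^ 2 / 2))
        = s * I + s ^ 2 * C := by
      rw [integral_add (hbi.const_mul s) (hqi.const_mul (s ^ 2)), integral_const_mul,
        integral_const_mul]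
    exact (h2.symm.le.trans h1).trans_eq h3
  have h4 := hquad (-I / (C + 1))
  have h5 : -I / (C + 1) * I + (-I / (C + 1)) ^ 2 * C = -(I / (C + 1)) ^ 2 := by
    field_simp
    ring
  rw [h5] at h4
  have h6 : I / (C + 1) = 0 := by
    rw [← sq_eq_zero_iff]
    linarith [sq_nonneg (I / (C + 1))]
  rcases div_eq_zero_iff.1 h6 with h7 | h7
  · exact h7
  · linarith

theorem tsupport_indicator_subset {X : Type*} [TopologicalSpace X] {φ : X → ℝ} {U W : Set X}
    (hW : IsOpen W) (hUW : Disjoint U W) (hφ : tsupport φ ⊆ U ∪ W) :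
    tsupport (U.indicator φ) ⊆ tsupport φ ∩ U := by
  intro x hx
  have hx1 : x ∈ tsupport φ := closure_mono (Set.support_indicator.subset.trans Set.inter_subset_right) hx
  refine ⟨hx1, (hφ hx1).resolve_right fun hxW => ?_⟩
  refine (notMem_tsupport_iff_eventuallyEq.2 ?_) hx
  filter_upwards [hW.mem_nhds hxW] with y hy
  exact Set.indicator_of_notMem (hUW.notMem_of_mem_right hy) φ

theorem ContDiff.indicator_of_tsupport_subset {E : Type*} [NormedAddCommGroup E] [NormedSpace ℝ E]
    {φ : E → ℝ} {k : WithTop ℕ∞} (hk : ContDiff ℝ k φ) {U W : Set E} (hU : IsOpen U)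
    (hW : IsOpen W) (hUW : Disjoint U W) (hφ : tsupport φ ⊆ U ∪ W) :
    ContDiff ℝ k (U.indicator φ) := by
  rw [contDiff_iff_contDiffAt]
  intro x
  by_cases hx : x ∈ U
  · refine hk.contDiffAt.congr_of_eventuallyEq ?_
    filter_upwards [hU.mem_nhds hx] with y hy
    exact Set.indicator_of_mem hy φ
  · have hx' : x ∉ tsupport (U.indicator φ) := fun h =>
      hx (tsupport_indicator_subset hW hUW hφ h).2
    exact contDiffAt_const.congr_of_eventuallyEq (notMem_tsupport_iff_eventuallyEq.1 hx')

theorem ContDiffOn.exists_contDiff_eventuallyEq {E : Type*} [NormedAddCommGroup E]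
    [NormedSpace ℝ E] [FiniteDimensional ℝ E] {η : E → ℝ} {k : ℕ} {D K : Set E} (hD : IsOpen D)
    (hη : ContDiffOn ℝ k η D) (hK : IsCompact K) (hKD : K ⊆ D) :
    ∃ h : E → ℝ, ContDiff ℝ k h ∧ ∀ x ∈ K, h =ᶠ[nhds x] η := by
  obtain ⟨t, htc, hKt, htD⟩ := exists_compact_between hK hD hKD
  obtain ⟨χ, hχ1, hχ0, -⟩ := exists_contMDiffMap_one_nhds_of_subset_interior (n := k)
    (modelWithCornersSelf ℝ E) hK.isClosed hKt
  have hχ : ContDiff ℝ k χ := χ.contMDiff.contDiff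
  refine ⟨fun x => χ x * η x, ?_, fun x hx => ?_⟩
  · rw [contDiff_iff_contDiffAt]
    intro x
    by_cases hx : x ∈ D
    · exact hχ.contDiffAt.mul (hη.contDiffAt (hD.mem_nhds hx))
    · refine contDiffAt_const (c := (0 : ℝ)).congr_of_eventuallyEq ?_
      filter_upwards [htc.isClosed.isOpen_compl.mem_nhds fun h => hx (htD h)] with y hy
      rw [hχ0 y hy, zero_mul]
  · filter_upwards [eventually_nhdsSet_iff_forall.1 hχ1 x hx] with y hy
    rw [hy, one_mul]

/-- The gradient along a level set that is a graph is a multiple of the upward normal. -/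
theorem gradient_eq_smul_snocL {n : ℕ} {f : EuclideanSpace ℝ (Fin (n + 1)) → ℝ}
    (hf : ContDiff ℝ 1 f) {h : EuclideanSpace ℝ (Fin n) → ℝ} (hh : ContDiff ℝ 1 h) {lam : ℝ}
    {x : EuclideanSpace ℝ (Fin n)} (hx : ∀ᶠ y in nhds x, f (snocL n (y, h y)) = lam) :
    gradient f (snocL n (x, h x))
      = gradient f (snocL n (x, h x)) (Fin.last n) • snocL n (-gradient h x, 1) := by
  have h1 : HasFDerivAt (fun y => snocL n (y, h y))
      ((snocL n).comp ((ContinuousLinearMap.id ℝ _).prod (fderiv ℝ h x))) x :=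
    (snocL n).hasFDerivAt.comp x
      ((hasFDerivAt_id (𝕜 := ℝ) x).prodMk (hh.differentiable one_ne_zero x).hasFDerivAt)
  have h2 : HasFDerivAt (fun y => f (snocL n (y, h y))) _ x :=
    (hf.differentiable one_ne_zero (snocL n (x, h x))).hasFDerivAt.comp x h1
  have h3 : HasFDerivAt (𝕜 := ℝ) (fun y => f (snocL n (y, h y))) 0 x :=
    (hasFDerivAt_const lam x).congr_of_eventuallyEq hx
  have h4 := h2.unique h3
  ext i
  refine Fin.lastCases ?_ (fun j => ?_) i
  · simp
  · have h5 : fderiv ℝ f (snocL n (x, h x)) (snocL n (EuclideanSpace.single j 1,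
        fderiv ℝ h x (EuclideanSpace.single j 1))) = 0 :=
      DFunLike.congr_fun h4 (EuclideanSpace.single j 1)
    have hsp : snocL n (EuclideanSpace.single j 1,
        fderiv ℝ h x (EuclideanSpace.single j 1)) = EuclideanSpace.single j.castSucc 1
          + fderiv ℝ h x (EuclideanSpace.single j 1) • EuclideanSpace.single (Fin.last n) 1 := by
      rw [← snocL_single_zero, ← snocL_zero_one, ← map_smul, ← map_add]
      simp
    rw [hsp, map_add, map_smul, ← gradient_apply_eq_fderiv, ← gradient_apply_eq_fderiv,
      ← gradient_apply_eq_fderiv, smul_eq_mul] at h5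
    rw [PiLp.smul_apply, snocL_castSucc, PiLp.neg_apply, smul_eq_mul]
    linarith

/-- If a level set of a C¹ weak solution of the 1-harmonic equation is locally
the graph of a C² function `η`, then `η` satisfies the minimal surface
equation weakly. -/
theorem level_set_graph_minimal (n : ℕ)
    (f : EuclideanSpace ℝ (Fin (n + 1)) → ℝ)
    (hf : ContDiff ℝ 1 f) (hf0 : ∀ x, gradient f x ≠ 0)
    (hweak : ∀ φ : EuclideanSpace ℝ (Fin (n + 1)) → ℝ,
      ContDiff ℝ (⊤ : ℕ∞) φ → HasCompactSupport φ →
      ∫ x, ⟪(‖gradient f x‖)⁻¹ • gradient f x, gradient φ x⟫ = 0)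
    (lam : ℝ) (D : Set (EuclideanSpace ℝ (Fin n))) (hD : IsOpen D)
    (η : EuclideanSpace ℝ (Fin n) → ℝ) (hη : ContDiffOn ℝ 2 η D)
    (hgraph : ∀ x' ∈ D,
      f ((WithLp.equiv 2 (Fin (n + 1) → ℝ)).symm (Fin.snoc (⇑x') (η x'))) = lam) :
    ∀ φ : EuclideanSpace ℝ (Fin n) → ℝ,
      ContDiff ℝ (⊤ : ℕ∞) φ → HasCompactSupport φ → tsupport φ ⊆ D →
      ∫ x' in D, ⟪(Real.sqrt (1 + ‖gradient η x'‖ ^ 2))⁻¹ • gradient η x',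
        gradient φ x'⟫ = 0 := by
  intro φ hφs hc hsub
  have hφ : ContDiff ℝ 1 φ := hφs.of_le (by exact_mod_cast le_top)
  obtain ⟨h, hh, hheq⟩ := ContDiffOn.exists_contDiff_eventuallyEq (k := 1) hD
    (by exact_mod_cast hη.of_le one_le_two) hc hsub
  replace hh : ContDiff ℝ 1 h := by exact_mod_cast hh
  set ν : EuclideanSpace ℝ (Fin (n + 1)) → EuclideanSpace ℝ (Fin (n + 1)) :=
    fun x => (‖gradient f x‖)⁻¹ • gradient f x
  have cf := hf.continuous_gradient
  have hν : Continuous ν := (cf.norm.inv₀ fun x => norm_ne_zero_iff.2 (hf0 x)).smul cf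
  have hν1 : ∀ x, ‖ν x‖ ≤ 1 := fun x => (norm_smul_inv_norm (𝕜 := ℝ) (hf0 x)).le
  set ω : EuclideanSpace ℝ (Fin n) → ℝ :=
    fun x => gradient f (snocL n (x, h x)) (Fin.last n) with hωdef
  have hω : Continuous ω := by
    have := hh.continuous
    simp only [hωdef]
    fun_prop
  have hgrad : ∀ x ∈ tsupport φ,
      gradient f (snocL n (x, h x)) = ω x • snocL n (-gradient h x, 1) := fun x hx => by
    refine gradient_eq_smul_snocL hf hh (lam := lam) ?_
    filter_upwards [hheq x hx, hD.mem_nhds (hsub hx)] with y hy hyD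
    rw [hy]
    exact hgraph y hyD
  have hflux : ∀ x ∈ tsupport φ, ⟪ν (snocL n (x, h x)), snocL n (-gradient h x, 1)⟫
      = ω x / |ω x| * Real.sqrt (1 + ‖gradient h x‖ ^ 2) := fun x hx => by
    have hN : ‖snocL n (-gradient h x, 1)‖ = Real.sqrt (1 + ‖gradient h x‖ ^ 2) := by
      rw [norm_snocL, norm_neg, one_pow]
    have hN0 : Real.sqrt (1 + ‖gradient h x‖ ^ 2) ≠ 0 :=
      (Real.sqrt_pos.2 (by positivity)).ne'
    simp only [ν]
    rw [hgrad x hx, norm_smul, smul_smul, real_inner_smul_left, real_inner_self_eq_norm_sq, hN,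
      Real.norm_eq_abs, mul_inv]
    field_simp
  have hω0 : ∀ x ∈ tsupport φ, ω x ≠ 0 := fun x hx h0 => by
    apply hf0 (snocL n (x, h x))
    rw [hgrad x hx, h0, zero_smul]
  set U := {x | 0 < ω x}
  set W := {x | ω x < 0}
  have hU : IsOpen U := isOpen_lt continuous_const hω
  have hW : IsOpen W := isOpen_lt hω continuous_const
  have hUW : Disjoint U W := Set.disjoint_left.2 fun x (hx : 0 < ω x) (hx' : ω x < 0) => lt_asymm hx hx'
  have hsUW : tsupport φ ⊆ U ∪ W := fun x hx => (hω0 x hx).lt_or_gt.symm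
  have hsWU : tsupport φ ⊆ W ∪ U := fun x hx => (hω0 x hx).lt_or_gt
  have tU := tsupport_indicator_subset hW hUW hsUW
  have tW := tsupport_indicator_subset hU hUW.symm hsWU
  have sU := hφ.indicator_of_tsupport_subset hU hW hUW hsUW
  have sW := hφ.indicator_of_tsupport_subset hW hU hUW.symm hsWU
  have hcU : HasCompactSupport (U.indicator φ) :=
    hc.of_isClosed_subset (isClosed_tsupport _) (tU.trans Set.inter_subset_left)
  have hcW : HasCompactSupport (W.indicator φ) :=
    hc.of_isClosed_subset (isClosed_tsupport _) (tW.trans Set.inter_subset_left)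
  have iU := integral_inner_gradient_eq_zero_of_calibrated hν hν1 hweak hh sU hcU
    fun x hx => by
      have hpos : 0 < ω x := (tU hx).2
      rw [hflux x (tU hx).1, abs_of_pos hpos, div_self hpos.ne', one_mul]
  have iW := integral_inner_gradient_eq_zero_of_calibrated (ν := fun x => -ν x) hν.neg
    (fun x => by rw [norm_neg]; exact hν1 x)
    (fun ψ hψ hψc => by simp_rw [inner_neg_left, integral_neg, neg_eq_zero]; exact hweak ψ hψ hψc)
    hh sW hcW
    fun x hx => by
      have hneg : ω x < 0 := (tW hx).2
      rw [inner_neg_left, hflux x (tW hx).1, abs_of_neg hneg, div_neg, div_self hneg.ne, neg_mul,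
        one_mul, neg_neg]
  have hsum : ∀ x, gradient φ x = gradient (U.indicator φ) x + gradient (W.indicator φ) x := by
    intro x
    have h1 : φ = fun y => U.indicator φ y + 1 * W.indicator φ y := by
      ext y
      rw [one_mul]
      by_cases hy : y ∈ tsupport φ
      · rcases hsUW hy with hyU | hyW
        · rw [Set.indicator_of_mem hyU, Set.indicator_of_notMem (hUW.notMem_of_mem_left hyU),
            add_zero]
        · rw [Set.indicator_of_mem hyW, Set.indicator_of_notMem (hUW.notMem_of_mem_right hyW),
            zero_add]
      · have := image_eq_zero_of_notMem_tsupport hy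
        simp [Set.indicator_apply, this]
    have h2 := sU.gradient_add_const_mul sW 1 x
    rw [← h1, one_smul] at h2
    exact h2
  have htotal : ∫ x, ⟪(Real.sqrt (1 + ‖gradient h x‖ ^ 2))⁻¹ • gradient h x, gradient φ x⟫ = 0 := by
    simp_rw [hsum, inner_add_right]
    rw [integral_add (integrable_inner_normalized_gradient hh sU hcU)
      (integrable_inner_normalized_gradient hh sW hcW), iU, iW, add_zero]
  rw [setIntegral_eq_integral_of_forall_compl_eq_zero fun x hx => by
    rw [gradient_eq_zero_of_notMem_tsupport fun h' => hx (hsub h'), inner_zero_right]]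
  rw [← htotal]
  congr 1
  ext x
  by_cases hx : x ∈ tsupport φ
  · rw [(hheq x hx).gradient_eq]
  · rw [gradient_eq_zero_of_notMem_tsupport hx, inner_zero_right, inner_zero_right]
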